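/- For |q|<1, φ²(q)·φ²(q⁷) = 1 + (4/3)·∑_{j≥1} ( jq^j/(1−q^j) − 2jq^{2j}/(1−q^{2j}) + 4jq^{4j}/(1−q^{4j}) − 7jq^{7j}/(1−q^{7j}) + 14jq^{14j}/(1−q^{14j}) − 28jq^{28j}/(1−q^{28j}) ) + (8/3)·η₂⁴η₁₄⁴/(η₁η₄η₇η₂₈). -/

import Mathlib

noncomputable section

open Filter Topology Finset ModularForm

/-- The finite `q`-Pochhammer symbol `∏_{k=1}^n (1 - q^k)`. -/
def qPoch (q : ℂ) (n : ℕ) : ℂ := ∏ k ∈ range n, (1 - q ^ (k + 1))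

lemma qPoch_succ (q : ℂ) (n : ℕ) : qPoch q (n + 1) = qPoch q n * (1 - q ^ (n + 1)) :=
  prod_range_succ _ _

lemma one_sub_pow_ne_zero {q : ℂ} (hq : ‖q‖ < 1) (n : ℕ) : 1 - q ^ (n + 1) ≠ 0 := by
  intro h
  have h1 : ‖q ^ (n + 1)‖ = 1 := by rw [← sub_eq_zero.mp h, norm_one]
  rw [norm_pow] at h1
  exact (pow_lt_one₀ (norm_nonneg _) hq n.succ_ne_zero).ne h1

lemma qPoch_ne_zero {q : ℂ} (hq : ‖q‖ < 1) (n : ℕ) : qPoch q n ≠ 0 :=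
  prod_ne_zero_iff.mpr fun k _ ↦ one_sub_pow_ne_zero hq k

/-- The Gaussian binomial theorem. -/
lemma prod_one_add_mul_pow {q : ℂ} (hq : ‖q‖ < 1) (x : ℂ) (n : ℕ) :
    ∏ k ∈ range n, (1 + x * q ^ k) =
      ∑ j ∈ range (n + 1),
        qPoch q n / (qPoch q j * qPoch q (n - j)) * q ^ j.choose 2 * x ^ j := by
  induction n with
  | zero => simp [qPoch]
  | succ n ih =>
    rw [prod_range_succ, ih, mul_add, mul_one, sum_range_succ' _ (n + 1)]
    nth_rewrite 1 [sum_range_succ' _ n]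
    rw [sum_range_succ _ n, sum_range_succ _ n, add_mul, sum_mul]
    have h0 := qPoch_ne_zero hq
    have key : ∀ j ∈ range n,
        qPoch q (n + 1) / (qPoch q (j + 1) * qPoch q (n + 1 - (j + 1))) * q ^ (j + 1).choose 2
          * x ^ (j + 1) =
        qPoch q n / (qPoch q (j + 1) * qPoch q (n - (j + 1))) * q ^ (j + 1).choose 2
          * x ^ (j + 1) +
        qPoch q n / (qPoch q j * qPoch q (n - j)) * q ^ j.choose 2 * x ^ j * (x * q ^ n) := by
      intro j hj
      obtain ⟨i, rfl⟩ := Nat.exists_eq_add_of_lt (mem_range.mp hj)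
      have e1 : j + i + 1 + 1 - (j + 1) = i + 1 := by omega
      have e2 : j + i + 1 - (j + 1) = i := by omega
      have e3 : j + i + 1 - j = i + 1 := by omega
      have e4 : (j + 1).choose 2 = j.choose 2 + j := by
        simp [Nat.choose_succ_succ' j 1, add_comm]
      rw [e1, e2, e3, e4, qPoch_succ q (j + i + 1), qPoch_succ q i, qPoch_succ q j]
      have h1 := h0 (j + i + 1)
      have h2 := h0 i
      have h3 := h0 j
      have h4 := one_sub_pow_ne_zero hq i
      have h5 := one_sub_pow_ne_zero hq j
      field_simp
      ring
    rw [sum_congr rfl key, sum_add_distrib]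
    have e4 : (n + 1).choose 2 = n.choose 2 + n := by
      simp [Nat.choose_succ_succ' n 1, add_comm]
    have h1 := h0 n
    have h2 := h0 (n + 1)
    have h3 : qPoch q 0 = 1 := by simp [qPoch]
    simp only [Nat.sub_self, h3, e4, Nat.sub_zero, mul_one, one_mul, pow_zero]
    have h4 : qPoch q n / qPoch q n = 1 := div_self h1
    have h5 : qPoch q (n + 1) / qPoch q (n + 1) = 1 := div_self h2
    simp only [h4, h5]
    ring

/-- The finite form of the Jacobi triple product. -/
lemma prod_jacobi_finite {q z : ℂ} (hq : ‖q‖ < 1) (hq0 : q ≠ 0) (hz : z ≠ 0) (n : ℕ) :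
    ∏ k ∈ range n, ((1 + z * q ^ (2 * k + 1)) * (1 + z⁻¹ * q ^ (2 * k + 1))) =
      ∑ j ∈ range (2 * n + 1), qPoch (q ^ 2) (2 * n) /
        (qPoch (q ^ 2) j * qPoch (q ^ 2) (2 * n - j)) *
          (q ^ (((j : ℤ) - n) ^ 2) * z ^ ((j : ℤ) - n)) := by
  have hq2 : ‖q ^ 2‖ < 1 := by
    rw [norm_pow]; exact pow_lt_one₀ (norm_nonneg _) hq two_ne_zero
  have h := prod_one_add_mul_pow hq2 (z * q ^ (1 - 2 * (n : ℤ))) (2 * n)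
  have hl : ∏ k ∈ range (2 * n), (1 + z * q ^ (1 - 2 * (n : ℤ)) * (q ^ 2) ^ k) =
      z ^ n * q ^ (-(n : ℤ) ^ 2) *
      ∏ k ∈ range n, ((1 + z * q ^ (2 * k + 1)) * (1 + z⁻¹ * q ^ (2 * k + 1))) := by
    have hA : ∏ k ∈ range n, (1 + z * q ^ (1 - 2 * (n : ℤ)) * (q ^ 2) ^ k) =
        z ^ n * q ^ (-(n : ℤ) ^ 2) * ∏ k ∈ range n, (1 + z⁻¹ * q ^ (2 * k + 1)) := by
      have hc : z ^ n * q ^ (-(n : ℤ) ^ 2) = ∏ k ∈ range n, (z * q ^ (-(2 * (k : ℤ) + 1))) := by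
        rw [prod_mul_distrib, prod_const, card_range]
        congr 1
        clear * - hq0
        induction n with
        | zero => simp
        | succ n ih =>
          rw [prod_range_succ, ← ih, ← zpow_add₀ hq0]
          congr 1; push_cast; ring
      rw [← prod_range_reflect, hc, ← prod_mul_distrib]
      refine prod_congr rfl fun k hk ↦ ?_
      have hk' : ((n - 1 - k : ℕ) : ℤ) = n - 1 - k := by
        have := mem_range.mp hk; omega
      rw [← pow_mul, ← zpow_natCast q (2 * (n - 1 - k)), ← zpow_natCast q (2 * k + 1), mul_assoc,
        ← zpow_add₀ hq0, mul_add, mul_one, mul_mul_mul_comm, mul_inv_cancel₀ hz,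
        ← zpow_add₀ hq0]
      push_cast
      rw [hk', add_comm]
      congr 2
      · congr 1; ring
      · simp
    have hB : ∏ k ∈ range n, (1 + z * q ^ (1 - 2 * (n : ℤ)) * (q ^ 2) ^ (n + k)) =
        ∏ k ∈ range n, (1 + z * q ^ (2 * k + 1)) := by
      refine prod_congr rfl fun k hk ↦ ?_
      rw [← pow_mul, ← zpow_natCast q (2 * (n + k)), ← zpow_natCast q (2 * k + 1), mul_assoc,
        ← zpow_add₀ hq0]
      push_cast
      congr 3; ring
    rw [two_mul, prod_range_add, hA, hB, prod_mul_distrib]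
    ring
  rw [hl] at h
  have hc : z ^ n * q ^ (-(n : ℤ) ^ 2) ≠ 0 := mul_ne_zero (pow_ne_zero _ hz) (zpow_ne_zero _ hq0)
  rw [← mul_right_inj' hc, h, mul_sum]
  refine sum_congr rfl fun j hj ↦ ?_
  rw [mul_left_comm _ (qPoch _ _ / _), mul_assoc]
  congr 1
  have hch : 2 * ((j.choose 2 : ℕ) : ℤ) = j * (j - 1) := by
    clear hj
    induction j with
    | zero => simp
    | succ j ih =>
      rw [Nat.choose_succ_succ' j 1]
      push_cast
      rw [mul_add, ih, Nat.choose_one_right]; ring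
  have hs : z ^ n * q ^ (-(n : ℤ) ^ 2) * (q ^ (((j : ℤ) - n) ^ 2) * z ^ ((j : ℤ) - n)) =
      q ^ (-(n : ℤ) ^ 2 + ((j : ℤ) - n) ^ 2) * z ^ ((n : ℤ) + ((j : ℤ) - n)) := by
    rw [zpow_add₀ hq0, zpow_add₀ hz, zpow_natCast]; ring
  rw [hs, mul_pow, ← zpow_natCast (q ^ _) j, ← zpow_mul, ← pow_mul, ← zpow_natCast q (2 * _),
    ← zpow_natCast z j, mul_left_comm, ← zpow_add₀ hq0, mul_comm]
  push_cast
  rw [hch]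
  congr 2 <;> ring

/-- The Euler product `∏_{n ≥ 1} (1 - q^n)`. -/
def eulerProd (q : ℂ) : ℂ := ∏' n : ℕ, (1 - q ^ (n + 1))

lemma eulerProd_ne_zero {q : ℂ} (hq : ‖q‖ < 1) : eulerProd q ≠ 0 := by
  refine tprod_one_add_ne_zero_of_summable (f := fun n ↦ -q ^ (n + 1)) ?_ ?_
  · intro n
    rw [← sub_eq_add_neg]
    exact one_sub_pow_ne_zero hq n
  · simpa using (summable_nat_add_iff 1).mpr (summable_geometric_of_lt_one (norm_nonneg _) hq)

lemma tendsto_qPoch {q : ℂ} (hq : ‖q‖ < 1) :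
    Tendsto (qPoch q) atTop (𝓝 (eulerProd q)) :=
  (multipliable_one_sub_pow hq).hasProd.tendsto_prod_nat

lemma norm_pow_lt_one {q : ℂ} (hq : ‖q‖ < 1) {k : ℕ} (hk : k ≠ 0) : ‖q ^ k‖ < 1 := by
  rw [norm_pow]; exact pow_lt_one₀ (norm_nonneg _) hq hk

lemma multipliable_one_add_mul_pow_odd {q : ℂ} (hq : ‖q‖ < 1) (z : ℂ) :
    Multipliable fun k : ℕ ↦ 1 + z * q ^ (2 * k + 1) := by
  apply multipliable_one_add_of_summable
  simp only [norm_mul, norm_pow, pow_add, pow_mul, pow_one]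
  refine Summable.mul_left _ (Summable.mul_right _ (summable_geometric_of_lt_one (by positivity) ?_))
  exact pow_lt_one₀ (norm_nonneg _) hq two_ne_zero

lemma summable_nat_pow_sq_mul_pow {a w : ℝ} (ha0 : 0 < a) (ha : a < 1) (hw : 0 < w) :
    Summable fun n : ℕ ↦ a ^ (n ^ 2) * w ^ n := by
  refine summable_of_ratio_test_tendsto_lt_one (l := 0) one_pos
    (.of_forall fun n ↦ by positivity) ?_
  have h : Tendsto (fun n : ℕ ↦ (a ^ 2) ^ n * (a * w)) atTop (𝓝 0) := by
    simpa using (tendsto_pow_atTop_nhds_zero_of_lt_one (by positivity)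
      (pow_lt_one₀ ha0.le ha two_ne_zero)).mul_const (a * w)
  refine h.congr fun n ↦ ?_
  rw [Real.norm_of_nonneg (by positivity), Real.norm_of_nonneg (by positivity),
    eq_div_iff (by positivity)]
  ring

lemma summable_norm_zpow_sq_mul_zpow {q z : ℂ} (hq : ‖q‖ < 1) (hq0 : q ≠ 0) (hz : z ≠ 0) :
    Summable fun n : ℤ ↦ ‖q ^ (n ^ 2) * z ^ n‖ := by
  have h1 := norm_pos_iff.mpr hq0
  have h2 := norm_pos_iff.mpr hz
  refine Summable.of_nat_of_neg ?_ ?_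
  · refine (summable_nat_pow_sq_mul_pow h1 hq h2).congr fun n ↦ ?_
    rw [norm_mul, norm_zpow, norm_zpow]
    norm_cast
  · refine (summable_nat_pow_sq_mul_pow h1 hq (inv_pos.mpr h2)).congr fun n ↦ ?_
    rw [norm_mul, norm_zpow, norm_zpow, zpow_neg, neg_sq, inv_pow]
    norm_cast

/-- The Jacobi triple product identity. -/
lemma tsum_zpow_sq_mul_zpow {q z : ℂ} (hq : ‖q‖ < 1) (hq0 : q ≠ 0) (hz : z ≠ 0) :
    ∑' n : ℤ, q ^ (n ^ 2) * z ^ n = eulerProd (q ^ 2) *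
      ((∏' k : ℕ, (1 + z * q ^ (2 * k + 1))) * ∏' k : ℕ, (1 + z⁻¹ * q ^ (2 * k + 1))) := by
  have hq2 := norm_pow_lt_one hq two_ne_zero
  have hlim := tendsto_qPoch hq2
  have hE := eulerProd_ne_zero hq2
  obtain ⟨B, hB⟩ := (Metric.isBounded_range_of_tendsto _ hlim).exists_norm_le
  obtain ⟨C, hC⟩ := (Metric.isBounded_range_of_tendsto _ (hlim.inv₀ hE)).exists_norm_le
  have hB' : ∀ n, ‖qPoch (q ^ 2) n‖ ≤ B := fun n ↦ hB _ ⟨n, rfl⟩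
  have hC' : ∀ n, ‖(qPoch (q ^ 2) n)⁻¹‖ ≤ C := fun n ↦ hC _ ⟨n, rfl⟩
  have hB0 : 0 ≤ B := (norm_nonneg _).trans (hB' 0)
  have hC0 : 0 ≤ C := (norm_nonneg _).trans (hC' 0)
  let F : ℕ → ℤ → ℂ := fun n i ↦ if i ∈ Icc (-(n : ℤ)) n then
    qPoch (q ^ 2) (2 * n) * (qPoch (q ^ 2) (n + i).toNat)⁻¹ * (qPoch (q ^ 2) (n - i).toNat)⁻¹ *
      (q ^ (i ^ 2) * z ^ i) else 0
  have hF : ∀ n, ∑' i, F n i =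
      ∏ k ∈ range n, ((1 + z * q ^ (2 * k + 1)) * (1 + z⁻¹ * q ^ (2 * k + 1))) := by
    intro n
    rw [prod_jacobi_finite hq hq0 hz, tsum_eq_sum (s := Icc (-(n : ℤ)) n)
      (fun i hi ↦ by simp only [F, if_neg hi])]
    symm
    refine sum_nbij' (fun j ↦ (j : ℤ) - n) (fun i ↦ (n + i).toNat) ?_ ?_ ?_ ?_ ?_
    · intro j hj; simp only [mem_range, mem_Icc] at *; omega
    · intro j hj; simp only [mem_range, mem_Icc] at *; omega
    · intro j hj; simp only [mem_range] at *; omega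
    · intro j hj; simp only [mem_Icc] at *; omega
    · intro j hj
      have hj' : (j : ℤ) - n ∈ Icc (-(n : ℤ)) n := by
        simp only [mem_range, mem_Icc] at *; omega
      have e1 : ((n : ℤ) + (j - n)).toNat = j := by omega
      have e2 : ((n : ℤ) - (j - n)).toNat = 2 * n - j := by simp only [mem_range] at *; omega
      simp only [F, if_pos hj', e1, e2]
      simp only [div_eq_mul_inv, mul_inv, mul_assoc]
  have hconv : Tendsto (fun n ↦ ∑' i, F n i) atTop
      (𝓝 (∑' i : ℤ, (eulerProd (q ^ 2))⁻¹ * (q ^ (i ^ 2) * z ^ i))) := by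
    refine tendsto_tsum_of_dominated_convergence
      (bound := fun i ↦ B * C * C * ‖q ^ (i ^ 2) * z ^ i‖)
      ((summable_norm_zpow_sq_mul_zpow hq hq0 hz).mul_left _) ?_ ?_
    · intro i
      have t1 : Tendsto (fun n : ℕ ↦ 2 * n) atTop atTop :=
        tendsto_atTop_mono (fun n ↦ show n ≤ 2 * n by omega) tendsto_id
      have t2 : Tendsto (fun n : ℕ ↦ ((n : ℤ) + i).toNat) atTop atTop :=
        tendsto_atTop_mono (f := fun n ↦ n - i.natAbs) (fun n ↦ by omega)
          (tendsto_sub_atTop_nat _)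
      have t3 : Tendsto (fun n : ℕ ↦ ((n : ℤ) - i).toNat) atTop atTop :=
        tendsto_atTop_mono (f := fun n ↦ n - i.natAbs) (fun n ↦ by omega)
          (tendsto_sub_atTop_nat _)
      have h := (((hlim.comp t1).mul ((hlim.comp t2).inv₀ hE)).mul
        ((hlim.comp t3).inv₀ hE)).mul_const (q ^ (i ^ 2) * z ^ i)
      rw [mul_inv_cancel₀ hE, one_mul] at h
      refine h.congr' ?_
      filter_upwards [eventually_ge_atTop i.natAbs] with n hn
      have hi : i ∈ Icc (-(n : ℤ)) n := by simp only [mem_Icc]; omega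
      simp only [F, if_pos hi, Function.comp]
    · refine .of_forall fun n i ↦ ?_
      by_cases hi : i ∈ Icc (-(n : ℤ)) n
      · simp only [F, if_pos hi]
        rw [norm_mul, norm_mul, norm_mul]
        gcongr
        · exact hB' _
        · exact hC' _
        · exact hC' _
      · simp only [F, if_neg hi, norm_zero]
        positivity
  have hprod := ((multipliable_one_add_mul_pow_odd hq z).hasProd.tendsto_prod_nat).mul
    ((multipliable_one_add_mul_pow_odd hq z⁻¹).hasProd.tendsto_prod_nat)
  simp only [hF, prod_mul_distrib] at hconv
  rw [tendsto_nhds_unique hprod hconv, tsum_mul_left, mul_inv_cancel_left₀ hE]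

lemma multipliable_one_sub_pow_odd {q : ℂ} (hq : ‖q‖ < 1) :
    Multipliable fun k : ℕ ↦ 1 - q ^ (2 * k + 1) := by
  simpa [sub_eq_add_neg] using multipliable_one_add_mul_pow_odd hq (-1)

lemma multipliable_one_add_pow_odd {q : ℂ} (hq : ‖q‖ < 1) :
    Multipliable fun k : ℕ ↦ 1 + q ^ (2 * k + 1) := by
  simpa using multipliable_one_add_mul_pow_odd hq 1

lemma tprod_one_sub_pow_odd {q : ℂ} (hq : ‖q‖ < 1) :
    ∏' k : ℕ, (1 - q ^ (2 * k + 1)) = eulerProd q / eulerProd (q ^ 2) := by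
  rw [eq_div_iff (eulerProd_ne_zero (norm_pow_lt_one hq two_ne_zero)), eulerProd, eulerProd]
  have h : ∀ k : ℕ, 1 - (q ^ 2) ^ (k + 1) = 1 - q ^ (2 * k + 1 + 1) := fun k ↦ by
    rw [← pow_mul]; ring_nf
  simp only [h]
  refine tprod_even_mul_odd (f := fun n ↦ 1 - q ^ (n + 1)) (multipliable_one_sub_pow_odd hq) ?_
  simpa only [h] using multipliable_one_sub_pow (norm_pow_lt_one hq two_ne_zero)

lemma tprod_one_add_pow_odd {q : ℂ} (hq : ‖q‖ < 1) :
    ∏' k : ℕ, (1 + q ^ (2 * k + 1)) =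
      eulerProd (q ^ 2) ^ 2 / (eulerProd q * eulerProd (q ^ 4)) := by
  have h1 := tprod_one_sub_pow_odd hq
  have h2 := tprod_one_sub_pow_odd (norm_pow_lt_one hq two_ne_zero)
  have h3 : (∏' k : ℕ, (1 - q ^ (2 * k + 1))) * ∏' k : ℕ, (1 + q ^ (2 * k + 1)) =
      ∏' k : ℕ, (1 - (q ^ 2) ^ (2 * k + 1)) := by
    rw [← (multipliable_one_sub_pow_odd hq).tprod_mul (multipliable_one_add_pow_odd hq)]
    refine tprod_congr fun k ↦ ?_
    ring
  rw [h1, h2, ← pow_mul] at h3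
  have e1 := eulerProd_ne_zero hq
  have e2 := eulerProd_ne_zero (norm_pow_lt_one hq two_ne_zero)
  have e4 := eulerProd_ne_zero (norm_pow_lt_one hq four_ne_zero)
  norm_num at h3
  field_simp at h3 ⊢
  linear_combination h3

lemma tsum_zpow_sq {q : ℂ} (hq : ‖q‖ < 1) (hq0 : q ≠ 0) :
    ∑' n : ℤ, q ^ (n ^ 2) =
      eulerProd (q ^ 2) ^ 5 / (eulerProd q ^ 2 * eulerProd (q ^ 4) ^ 2) := by
  have h := tsum_zpow_sq_mul_zpow hq hq0 one_ne_zero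
  simp only [one_zpow, mul_one, inv_one, one_mul] at h
  rw [h, tprod_one_add_pow_odd hq]
  ring

lemma tsum_neg_one_zpow_mul_zpow_sq {q : ℂ} (hq : ‖q‖ < 1) (hq0 : q ≠ 0) :
    ∑' n : ℤ, q ^ (n ^ 2) * (-1) ^ n = eulerProd q ^ 2 / eulerProd (q ^ 2) := by
  have h := tsum_zpow_sq_mul_zpow hq hq0 (neg_ne_zero.mpr one_ne_zero)
  simp only [inv_neg, inv_one, neg_mul, one_mul, ← sub_eq_add_neg] at h
  have e2 := eulerProd_ne_zero (norm_pow_lt_one hq two_ne_zero)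
  rw [h, tprod_one_sub_pow_odd hq]
  field_simp

lemma tsum_zpow_sq_add {q : ℂ} (hq : ‖q‖ < 1) (hq0 : q ≠ 0) :
    ∑' n : ℤ, q ^ (n ^ 2 + n) = 2 * eulerProd (q ^ 4) ^ 2 / eulerProd (q ^ 2) := by
  have hq2 := norm_pow_lt_one hq two_ne_zero
  have h := tsum_zpow_sq_mul_zpow hq hq0 hq0
  simp only [← zpow_add₀ hq0] at h
  have e2 := eulerProd_ne_zero hq2
  have hm : Multipliable fun k : ℕ ↦ 1 + (q ^ 2) ^ (k + 1) := by
    convert multipliable_one_add_mul_pow_odd hq q using 2 with k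
    ring
  have h1 : ∏' k : ℕ, (1 + q * q ^ (2 * k + 1)) = ∏' k : ℕ, (1 + (q ^ 2) ^ (k + 1)) :=
    tprod_congr fun k ↦ by ring
  have h2 : ∏' k : ℕ, (1 + q⁻¹ * q ^ (2 * k + 1)) = 2 * ∏' k : ℕ, (1 + (q ^ 2) ^ (k + 1)) := by
    have : ∀ k : ℕ, 1 + q⁻¹ * q ^ (2 * k + 1) = 1 + (q ^ 2) ^ k := fun k ↦ by
      rw [pow_succ', inv_mul_cancel_left₀ hq0, pow_mul]
    simp only [this]
    rw [tprod_eq_zero_mul' (f := fun k ↦ 1 + (q ^ 2) ^ k) hm]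
    norm_num
  have h3 : eulerProd (q ^ 2) * ∏' k : ℕ, (1 + (q ^ 2) ^ (k + 1)) = eulerProd (q ^ 4) := by
    rw [eulerProd, eulerProd, ← (multipliable_one_sub_pow hq2).tprod_mul hm]
    exact tprod_congr fun k ↦ by ring
  rw [h, h1, h2, ← h3]
  field_simp

lemma tsum_zpow_triangular {q : ℂ} (hq : ‖q‖ < 1) (hq0 : q ≠ 0) :
    ∑' n : ℤ, q ^ (2 * n ^ 2 + n) = eulerProd (q ^ 2) ^ 2 / eulerProd q := by
  have h := tsum_zpow_sq_mul_zpow (norm_pow_lt_one hq two_ne_zero) (pow_ne_zero 2 hq0) hq0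
  have h0 : ∀ n : ℤ, (q ^ 2) ^ n ^ 2 * q ^ n = q ^ (2 * n ^ 2 + n) := fun n ↦ by
    rw [← zpow_natCast q 2, ← zpow_mul, ← zpow_add₀ hq0]; rfl
  have h1 : ∀ k : ℕ, 1 + q * (q ^ 2) ^ (2 * k + 1) = 1 + q ^ (2 * (2 * k + 1) + 1) :=
    fun k ↦ by ring
  have h2 : ∀ k : ℕ, 1 + q⁻¹ * (q ^ 2) ^ (2 * k + 1) = 1 + q ^ (2 * (2 * k) + 1) := fun k ↦ by
    rw [← pow_mul, show 2 * (2 * k + 1) = 2 * (2 * k) + 1 + 1 by ring, pow_succ' _ (2 * (2 * k) + 1),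
      inv_mul_cancel_left₀ hq0]
  have hm1 := multipliable_one_add_mul_pow_odd (norm_pow_lt_one hq two_ne_zero) q
  have hm2 := multipliable_one_add_mul_pow_odd (norm_pow_lt_one hq two_ne_zero) q⁻¹
  simp only [h0, h1, h2] at h hm1 hm2
  have e1 := eulerProd_ne_zero hq
  have e4 := eulerProd_ne_zero (norm_pow_lt_one hq four_ne_zero)
  rw [h, mul_comm (∏' k : ℕ, _) (∏' k : ℕ, _),
    tprod_even_mul_odd (f := fun n ↦ 1 + q ^ (2 * n + 1)) hm2 hm1, tprod_one_add_pow_odd hq,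
    ← pow_mul]
  field_simp

lemma tsum_neg_one_zpow_mul_zpow_triangular {q : ℂ} (hq : ‖q‖ < 1) (hq0 : q ≠ 0) :
    ∑' n : ℤ, q ^ (2 * n ^ 2 + n) * (-1) ^ n =
      eulerProd q * eulerProd (q ^ 4) / eulerProd (q ^ 2) := by
  have h := tsum_zpow_sq_mul_zpow (norm_pow_lt_one hq two_ne_zero) (pow_ne_zero 2 hq0)
    (neg_ne_zero.mpr hq0)
  have h0 : ∀ n : ℤ, (q ^ 2) ^ n ^ 2 * (-q) ^ n = q ^ (2 * n ^ 2 + n) * (-1) ^ n := fun n ↦ by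
    rw [← zpow_natCast q 2, ← zpow_mul, zpow_add₀ hq0, neg_eq_neg_one_mul, mul_zpow, mul_assoc,
      mul_comm ((-1) ^ n)]
    rfl
  have h1 : ∀ k : ℕ, 1 + -q * (q ^ 2) ^ (2 * k + 1) = 1 - q ^ (2 * (2 * k + 1) + 1) :=
    fun k ↦ by ring
  have h2 : ∀ k : ℕ, 1 + (-q)⁻¹ * (q ^ 2) ^ (2 * k + 1) = 1 - q ^ (2 * (2 * k) + 1) := fun k ↦ by
    rw [← pow_mul, show 2 * (2 * k + 1) = 2 * (2 * k) + 1 + 1 by ring, pow_succ' _ (2 * (2 * k) + 1),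
      inv_neg, neg_mul, inv_mul_cancel_left₀ hq0, sub_eq_add_neg]
  have hm1 := multipliable_one_add_mul_pow_odd (norm_pow_lt_one hq two_ne_zero) (-q)
  have hm2 := multipliable_one_add_mul_pow_odd (norm_pow_lt_one hq two_ne_zero) (-q)⁻¹
  simp only [h0, h1, h2] at h hm1 hm2
  rw [h, mul_comm (∏' k : ℕ, _) (∏' k : ℕ, _),
    tprod_even_mul_odd (f := fun n ↦ 1 - q ^ (2 * n + 1)) hm2 hm1, tprod_one_sub_pow_odd hq,
    ← pow_mul]
  ring

lemma summable_norm_zpow_sq {q : ℂ} (hq : ‖q‖ < 1) (hq0 : q ≠ 0) :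
    Summable fun n : ℤ ↦ ‖q ^ (n ^ 2)‖ := by
  simpa using summable_norm_zpow_sq_mul_zpow hq hq0 one_ne_zero

lemma summable_norm_zpow_sq_mul_neg_one {q : ℂ} (hq : ‖q‖ < 1) (hq0 : q ≠ 0) :
    Summable fun n : ℤ ↦ ‖q ^ (n ^ 2) * (-1) ^ n‖ :=
  summable_norm_zpow_sq_mul_zpow hq hq0 (neg_ne_zero.mpr one_ne_zero)

lemma summable_norm_zpow_triangular {q : ℂ} (hq : ‖q‖ < 1) (hq0 : q ≠ 0) :
    Summable fun n : ℤ ↦ ‖q ^ (2 * n ^ 2 + n)‖ := by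
  refine (summable_norm_zpow_sq_mul_zpow (norm_pow_lt_one hq two_ne_zero) (pow_ne_zero 2 hq0)
    hq0).congr fun n ↦ ?_
  rw [← zpow_natCast q 2, ← zpow_mul, ← zpow_add₀ hq0]
  rfl

lemma neg_one_zpow_mul_zpow_of_even {m n : ℤ} (h : Even (m + n)) :
    (-1 : ℂ) ^ m * (-1) ^ n = 1 := by
  rw [← zpow_add₀ (neg_ne_zero.mpr one_ne_zero), h.neg_one_zpow]

lemma neg_one_zpow_mul_zpow_of_odd {m n : ℤ} (h : Odd (m + n)) :
    (-1 : ℂ) ^ m * (-1) ^ n = -1 := by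
  rw [← zpow_add₀ (neg_ne_zero.mpr one_ne_zero), h.neg_one_zpow]

lemma tsum_zpow_sq_sq_add {q : ℂ} (hq : ‖q‖ < 1) (hq0 : q ≠ 0) :
    (∑' n : ℤ, q ^ (n ^ 2)) ^ 2 + (∑' n : ℤ, q ^ (n ^ 2) * (-1) ^ n) ^ 2 =
      2 * (∑' n : ℤ, (q ^ 2) ^ (n ^ 2)) ^ 2 := by
  have s1 := summable_norm_zpow_sq hq hq0
  have s2 := summable_norm_zpow_sq_mul_neg_one hq hq0
  have s3 := summable_norm_zpow_sq (norm_pow_lt_one hq two_ne_zero) (pow_ne_zero 2 hq0)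
  rw [pow_two, pow_two, pow_two (∑' n : ℤ, (q ^ 2) ^ (n ^ 2)),
    tsum_mul_tsum_of_summable_norm s1 s1, tsum_mul_tsum_of_summable_norm s2 s2,
    tsum_mul_tsum_of_summable_norm s3 s3, ← tsum_mul_left,
    ← (summable_mul_of_summable_norm s1 s1).tsum_add (summable_mul_of_summable_norm s2 s2)]
  have hinj : Function.Injective fun p : ℤ × ℤ ↦ (p.1 + p.2, p.1 - p.2) := by
    rintro ⟨a, b⟩ ⟨c, d⟩ h
    simp only [Prod.mk.injEq] at h ⊢
    omega
  rw [← hinj.tsum_eq]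
  · refine tsum_congr fun ⟨a, b⟩ ↦ ?_
    dsimp only
    rw [mul_mul_mul_comm, neg_one_zpow_mul_zpow_of_even ⟨a, by ring⟩, ← zpow_natCast q 2,
      ← zpow_mul, ← zpow_mul, ← zpow_add₀ hq0, ← zpow_add₀ hq0, mul_one, ← two_mul]
    push_cast
    congr 2; ring
  · rintro ⟨x, y⟩ h
    rcases Int.even_or_odd (x + y) with ⟨k, hk⟩ | hxy
    · exact ⟨(k, x - k), by simp only [Prod.mk.injEq]; omega⟩
    · refine absurd ?_ h
      dsimp only
      rw [mul_mul_mul_comm, neg_one_zpow_mul_zpow_of_odd hxy]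
      ring

lemma tsum_zpow_sq_sq_sub {q : ℂ} (hq : ‖q‖ < 1) (hq0 : q ≠ 0) :
    (∑' n : ℤ, q ^ (n ^ 2)) ^ 2 - (∑' n : ℤ, q ^ (n ^ 2) * (-1) ^ n) ^ 2 =
      2 * q * (∑' n : ℤ, (q ^ 2) ^ (n ^ 2 + n)) ^ 2 := by
  have hq2 := norm_pow_lt_one hq two_ne_zero
  have hq20 : q ^ 2 ≠ 0 := pow_ne_zero 2 hq0
  have s1 := summable_norm_zpow_sq hq hq0
  have s2 := summable_norm_zpow_sq_mul_neg_one hq hq0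
  have s3 : Summable fun n : ℤ ↦ ‖(q ^ 2) ^ (n ^ 2 + n)‖ :=
    (summable_norm_zpow_sq_mul_zpow hq2 hq20 hq20).congr fun n ↦ by rw [zpow_add₀ hq20]
  rw [pow_two, pow_two, pow_two (∑' n : ℤ, (q ^ 2) ^ (n ^ 2 + n)),
    tsum_mul_tsum_of_summable_norm s1 s1, tsum_mul_tsum_of_summable_norm s2 s2,
    tsum_mul_tsum_of_summable_norm s3 s3, ← tsum_mul_left,
    ← (summable_mul_of_summable_norm s1 s1).tsum_sub (summable_mul_of_summable_norm s2 s2)]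
  have hinj : Function.Injective fun p : ℤ × ℤ ↦ (p.1 + p.2 + 1, p.1 - p.2) := by
    rintro ⟨a, b⟩ ⟨c, d⟩ h
    simp only [Prod.mk.injEq] at h ⊢
    omega
  rw [← hinj.tsum_eq]
  · refine tsum_congr fun ⟨a, b⟩ ↦ ?_
    dsimp only
    rw [mul_mul_mul_comm, neg_one_zpow_mul_zpow_of_odd ⟨a, by ring⟩, ← zpow_natCast q 2,
      ← zpow_mul, ← zpow_mul, ← zpow_add₀ hq0, ← zpow_add₀ hq0, mul_neg_one, sub_neg_eq_add,
      ← two_mul, mul_assoc, ← zpow_one_add₀ hq0]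
    push_cast
    congr 2; ring
  · rintro ⟨x, y⟩ h
    rcases Int.even_or_odd (x + y) with hxy | ⟨k, hk⟩
    · refine absurd ?_ h
      dsimp only
      rw [mul_mul_mul_comm, neg_one_zpow_mul_zpow_of_even hxy]
      ring
    · exact ⟨(k, x - k - 1), by simp only [Prod.mk.injEq]; omega⟩

lemma tsum_zpow_triangular_mul_seven {q : ℂ} (hq : ‖q‖ < 1) (hq0 : q ≠ 0) :
    (∑' n : ℤ, q ^ (2 * n ^ 2 + n)) * (∑' n : ℤ, (q ^ 7) ^ (2 * n ^ 2 + n)) -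
      (∑' n : ℤ, q ^ (2 * n ^ 2 + n) * (-1) ^ n) *
        (∑' n : ℤ, (q ^ 7) ^ (2 * n ^ 2 + n) * (-1) ^ n) =
      2 * q * ((∑' n : ℤ, (q ^ 2) ^ (2 * n ^ 2 + n)) *
        ∑' n : ℤ, (q ^ 14) ^ (2 * n ^ 2 + n)) := by
  have s : ∀ k : ℕ, k ≠ 0 → Summable fun n : ℤ ↦ ‖(q ^ k) ^ (2 * n ^ 2 + n)‖ := fun k hk ↦
    summable_norm_zpow_triangular (norm_pow_lt_one hq hk) (pow_ne_zero k hq0)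
  have s' : ∀ k : ℕ, k ≠ 0 → Summable fun n : ℤ ↦ ‖(q ^ k) ^ (2 * n ^ 2 + n) * (-1) ^ n‖ :=
    fun k hk ↦ (s k hk).congr fun n ↦ by simp
  have s1 := s 1 (by norm_num)
  have s1' := s' 1 (by norm_num)
  simp only [pow_one] at s1 s1'
  have s7 := s 7 (by norm_num)
  have s7' := s' 7 (by norm_num)
  have s2 := s 2 (by norm_num)
  have s14 := s 14 (by norm_num)
  rw [tsum_mul_tsum_of_summable_norm s1 s7, tsum_mul_tsum_of_summable_norm s1' s7',
    tsum_mul_tsum_of_summable_norm s2 s14, ← tsum_mul_left,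
    ← (summable_mul_of_summable_norm s1 s7).tsum_sub (summable_mul_of_summable_norm s1' s7')]
  let g : ℤ × ℤ → ℤ × ℤ := fun p ↦ if (p.1 + p.2) % 2 = 0
    then ((p.1 + p.2) / 2 - 4 * p.2 - 1, (p.1 + p.2) / 2)
    else (-((p.1 + p.2 + 1) / 2) + 4 * p.2 + 1, -((p.1 + p.2 + 1) / 2))
  have hinj : Function.Injective g := by
    rintro ⟨a, b⟩ ⟨c, d⟩ h
    simp only [g] at h
    split_ifs at h <;> simp only [Prod.mk.injEq] at h ⊢ <;> omega
  have hval : ∀ a b : ℤ, Odd ((g (a, b)).1 + (g (a, b)).2) ∧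
      (2 * (g (a, b)).1 ^ 2 + (g (a, b)).1) + 7 * (2 * (g (a, b)).2 ^ 2 + (g (a, b)).2) =
      1 + (2 * (2 * a ^ 2 + a) + 14 * (2 * b ^ 2 + b)) := by
    intro a b
    by_cases hab : (a + b) % 2 = 0
    · obtain ⟨k, hk⟩ : ∃ k, a + b = 2 * k := ⟨(a + b) / 2, by omega⟩
      have hk2 : (a + b) / 2 = k := by omega
      obtain rfl : a = 2 * k - b := by omega
      simp only [g, if_pos hab, hk2]
      refine ⟨⟨k - 2 * b - 1, by ring⟩, by ring⟩
    · obtain ⟨k, hk⟩ : ∃ k, a + b + 1 = 2 * k := ⟨(a + b + 1) / 2, by omega⟩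
      have hk2 : (a + b + 1) / 2 = k := by omega
      obtain rfl : a = 2 * k - b - 1 := by omega
      simp only [g, if_neg hab, hk2]
      refine ⟨⟨-k + 2 * b, by ring⟩, by ring⟩
  rw [← hinj.tsum_eq]
  · refine tsum_congr fun ⟨a, b⟩ ↦ ?_
    obtain ⟨h1, h2⟩ := hval a b
    dsimp only
    rw [mul_mul_mul_comm, neg_one_zpow_mul_zpow_of_odd h1, ← zpow_natCast q 2,
      ← zpow_natCast q 7, ← zpow_natCast q 14,
      ← zpow_mul, ← zpow_mul, ← zpow_mul, ← zpow_add₀ hq0, ← zpow_add₀ hq0, mul_neg_one,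
      sub_neg_eq_add, ← two_mul, mul_assoc, ← zpow_one_add₀ hq0]
    push_cast
    rw [h2]
  · rintro ⟨x, y⟩ h
    rcases Int.even_or_odd (x + y) with hxy | ⟨k, hk⟩
    · refine absurd ?_ h
      dsimp only
      rw [mul_mul_mul_comm, neg_one_zpow_mul_zpow_of_even hxy]
      ring
    · obtain ⟨l, hl | hl⟩ : ∃ l, k - y = 2 * l ∨ k - y = 2 * l + 1 :=
        ⟨(k - y) / 2, by omega⟩
      · refine ⟨(-2 * y - 1 - l, l), ?_⟩
        simp only [g]
        rw [if_neg (by omega), Prod.mk.injEq]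
        omega
      · refine ⟨(2 * y + l + 1, -l - 1), ?_⟩
        simp only [g]
        rw [if_pos (by omega), Prod.mk.injEq]
        omega

/-- The logarithmic derivative of the Euler product with respect to `q d/dq`. -/
def eulerLog (q : ℂ) : ℂ := q * logDeriv eulerProd q

lemma analyticAt_eulerProd {q : ℂ} (hq : ‖q‖ < 1) : AnalyticAt ℂ eulerProd q :=
  differentiableOn_tprod_one_sub_pow.analyticAt
    (Metric.isOpen_ball.mem_nhds (by simpa using hq))

lemma analyticAt_logDeriv_eulerProd {q : ℂ} (hq : ‖q‖ < 1) :
    AnalyticAt ℂ (logDeriv eulerProd) q :=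
  (analyticAt_eulerProd hq).deriv.div (analyticAt_eulerProd hq) (eulerProd_ne_zero hq)

lemma analyticAt_eulerLog {q : ℂ} (hq : ‖q‖ < 1) : AnalyticAt ℂ eulerLog q :=
  analyticAt_id.mul (analyticAt_logDeriv_eulerProd hq)

lemma logDeriv_one_sub_pow (q : ℂ) (n : ℕ) :
    logDeriv (fun x : ℂ ↦ 1 - x ^ (n + 1)) q = -((n + 1) * q ^ n / (1 - q ^ (n + 1))) := by
  rw [logDeriv_apply, deriv_const_sub, deriv_pow_field]
  push_cast
  rw [neg_div]

lemma summable_lambert {q : ℂ} (hq : ‖q‖ < 1) :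
    Summable fun n : ℕ ↦ ((n : ℂ) + 1) * q ^ n / (1 - q ^ (n + 1)) := by
  by_cases hq0 : q = 0
  · refine summable_of_ne_finset_zero (s := {0}) fun n hn ↦ ?_
    have : n ≠ 0 := by simpa using hn
    simp [hq0, this]
  have h := (summable_nat_add_iff (f := fun n : ℕ ↦ (n : ℂ) ^ 1 * q ^ n / (1 - q ^ n)) 1).mpr
    (summable_norm_pow_mul_geometric_div_one_sub 1 hq)
  refine (h.mul_left q⁻¹).congr fun n ↦ ?_
  rw [pow_one, pow_succ q n]
  push_cast
  field_simp

lemma logDeriv_eulerProd {q : ℂ} (hq : ‖q‖ < 1) :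
    logDeriv eulerProd q = -∑' n : ℕ, ((n : ℂ) + 1) * q ^ n / (1 - q ^ (n + 1)) := by
  have h := logDeriv_tprod_eq_tsum (f := fun n x ↦ 1 - x ^ (n + 1)) Metric.isOpen_ball
    (by simpa using hq : q ∈ Metric.ball (0 : ℂ) 1) (one_sub_pow_ne_zero hq) (by fun_prop)
    (by simpa only [logDeriv_one_sub_pow] using (summable_lambert hq).neg)
    multipliableLocallyUniformlyOn_one_sub_pow (eulerProd_ne_zero hq)
  simp only [logDeriv_one_sub_pow, tsum_neg] at h
  exact h

lemma logDeriv_eulerProd_zero : logDeriv eulerProd 0 = -1 := by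
  rw [logDeriv_eulerProd (by simp), tsum_eq_single 0 (fun n hn ↦ by simp [hn])]
  simp

lemma eulerProd_zero : eulerProd 0 = 1 := by simp [eulerProd]

lemma hasSum_lambert {q : ℂ} (hq : ‖q‖ < 1) :
    HasSum (fun n : ℕ ↦ ((n : ℂ) + 1) * q ^ (n + 1) / (1 - q ^ (n + 1))) (-eulerLog q) := by
  rw [eulerLog, logDeriv_eulerProd hq, mul_neg, neg_neg]
  refine ((summable_lambert hq).hasSum.mul_left q).congr_fun fun n ↦ ?_
  ring

/-- `HasEulerLog f d q` says that `f` is differentiable at `q`, where `q d/dq` multiplies it by `d`. -/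
def HasEulerLog (f : ℂ → ℂ) (d q : ℂ) : Prop := HasDerivAt f (f q * d / q) q

namespace HasEulerLog

variable {f g : ℂ → ℂ} {d e q : ℂ}

lemma mul (hf : HasEulerLog f d q) (hg : HasEulerLog g e q) :
    HasEulerLog (fun x ↦ f x * g x) (d + e) q :=
  (HasDerivAt.fun_mul hf hg).congr_deriv (by ring)

lemma pow (hf : HasEulerLog f d q) (n : ℕ) : HasEulerLog (fun x ↦ f x ^ n) (n * d) q := by
  refine (HasDerivAt.fun_pow hf n).congr_deriv ?_
  cases n with
  | zero => simp
  | succ n => simp only [Nat.add_sub_cancel]; ring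

lemma div (hf : HasEulerLog f d q) (hg : HasEulerLog g e q) (h : g q ≠ 0) :
    HasEulerLog (fun x ↦ f x / g x) (d - e) q :=
  (HasDerivAt.fun_div hf hg h).congr_deriv (by field_simp)

lemma const_mul (c : ℂ) (hf : HasEulerLog f d q) : HasEulerLog (fun x ↦ c * f x) d q :=
  (HasDerivAt.const_mul c hf).congr_deriv (by ring)

lemma comp_pow {k : ℕ} (hq : q ≠ 0) (hf : HasEulerLog f d (q ^ k)) :
    HasEulerLog (fun x ↦ f (x ^ k)) (k * d) q := by
  refine (HasDerivAt.comp q hf (hasDerivAt_pow k q)).congr_deriv ?_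
  cases k with
  | zero => simp
  | succ k => simp only [Nat.add_sub_cancel]; field_simp; ring

end HasEulerLog

lemma hasEulerLog_id {q : ℂ} (hq : q ≠ 0) : HasEulerLog (fun x ↦ x) 1 q :=
  (hasDerivAt_id q).congr_deriv (by field_simp)

lemma hasEulerLog_eulerProd {q : ℂ} (hq : ‖q‖ < 1) (hq0 : q ≠ 0) :
    HasEulerLog eulerProd (eulerLog q) q := by
  refine (analyticAt_eulerProd hq).differentiableAt.hasDerivAt.congr_deriv ?_
  have := eulerProd_ne_zero hq
  rw [eulerLog, logDeriv_apply]
  field_simp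

lemma hasEulerLog_eulerProd_pow {q : ℂ} (hq : ‖q‖ < 1) (hq0 : q ≠ 0) {k : ℕ} (hk : k ≠ 0) :
    HasEulerLog (fun x ↦ eulerProd (x ^ k)) (k * eulerLog (q ^ k)) q :=
  (hasEulerLog_eulerProd (norm_pow_lt_one hq hk) (pow_ne_zero k hq0)).comp_pow hq0

/-- Ramanujan's `φ(q)` as an eta quotient. -/
def thetaPhi (q : ℂ) : ℂ := eulerProd (q ^ 2) ^ 5 / (eulerProd q ^ 2 * eulerProd (q ^ 4) ^ 2)

/-- Ramanujan's `φ(-q)` as an eta quotient. -/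
def thetaPhiNeg (q : ℂ) : ℂ := eulerProd q ^ 2 / eulerProd (q ^ 2)

/-- Ramanujan's `ψ(q)` as an eta quotient. -/
def thetaPsi (q : ℂ) : ℂ := eulerProd (q ^ 2) ^ 2 / eulerProd q

/-- Ramanujan's `ψ(-q)` as an eta quotient. -/
def thetaPsiNeg (q : ℂ) : ℂ := eulerProd q * eulerProd (q ^ 4) / eulerProd (q ^ 2)

lemma HasEulerLog.add_eq {f g h : ℂ → ℂ} {d e k q : ℂ} (hq0 : q ≠ 0) (hf : HasEulerLog f d q)
    (hg : HasEulerLog g e q) (hh : HasEulerLog h k q) (H : (fun x ↦ f x + g x) =ᶠ[𝓝 q] h) :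
    f q * d + g q * e = h q * k := by
  have := (HasDerivAt.fun_add hf hg).unique (HasDerivAt.congr_of_eventuallyEq hh H)
  field_simp at this
  linear_combination this

lemma HasEulerLog.congr_log {f : ℂ → ℂ} {d e q : ℂ} (hf : HasEulerLog f d q) (h : d = e) :
    HasEulerLog f e q := h ▸ hf

lemma eventually_norm_lt_one_ne_zero {q : ℂ} (hq : ‖q‖ < 1) (hq0 : q ≠ 0) :
    ∀ᶠ x in 𝓝 q, ‖x‖ < 1 ∧ x ≠ 0 :=
  (continuous_norm.continuousAt.eventually (gt_mem_nhds hq)).and (isOpen_ne.mem_nhds hq0)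

section thetaBasics

variable {q : ℂ}

lemma thetaPhi_ne_zero (hq : ‖q‖ < 1) : thetaPhi q ≠ 0 := by
  have h1 := eulerProd_ne_zero hq
  have h2 := eulerProd_ne_zero (norm_pow_lt_one hq (k := 2) (by simp))
  have h4 := eulerProd_ne_zero (norm_pow_lt_one hq (k := 4) (by simp))
  unfold thetaPhi
  positivity

lemma thetaPsi_ne_zero (hq : ‖q‖ < 1) : thetaPsi q ≠ 0 := by
  have h1 := eulerProd_ne_zero hq
  have h2 := eulerProd_ne_zero (norm_pow_lt_one hq (k := 2) (by simp))
  unfold thetaPsi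
  positivity

lemma thetaPsiNeg_ne_zero (hq : ‖q‖ < 1) : thetaPsiNeg q ≠ 0 := by
  have h1 := eulerProd_ne_zero hq
  have h2 := eulerProd_ne_zero (norm_pow_lt_one hq (k := 2) (by simp))
  have h4 := eulerProd_ne_zero (norm_pow_lt_one hq (k := 4) (by simp))
  unfold thetaPsiNeg
  positivity

lemma analyticAt_eulerProd_pow (hq : ‖q‖ < 1) {k : ℕ} (hk : k ≠ 0) :
    AnalyticAt ℂ (fun x ↦ eulerProd (x ^ k)) q :=
  AnalyticAt.comp (f := fun x : ℂ ↦ x ^ k) (analyticAt_eulerProd (norm_pow_lt_one hq hk))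
    (by fun_prop)

lemma analyticAt_thetaPhi (hq : ‖q‖ < 1) : AnalyticAt ℂ thetaPhi q := by
  have h1 := eulerProd_ne_zero hq
  have h4 := eulerProd_ne_zero (norm_pow_lt_one hq (k := 4) (by simp))
  exact ((analyticAt_eulerProd_pow hq (by simp)).pow 5).div (((analyticAt_eulerProd hq).pow 2).mul
    ((analyticAt_eulerProd_pow hq (by simp)).pow 2)) (by simp [h1, h4])

lemma analyticAt_thetaPsi (hq : ‖q‖ < 1) : AnalyticAt ℂ thetaPsi q :=
  ((analyticAt_eulerProd_pow hq (by simp)).pow 2).div (analyticAt_eulerProd hq)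
    (eulerProd_ne_zero hq)

lemma analyticAt_thetaPsiNeg (hq : ‖q‖ < 1) : AnalyticAt ℂ thetaPsiNeg q :=
  ((analyticAt_eulerProd hq).mul (analyticAt_eulerProd_pow hq (by simp))).div
    (analyticAt_eulerProd_pow hq (by simp))
    (eulerProd_ne_zero (norm_pow_lt_one hq (k := 2) (by simp)))

lemma thetaPhi_zero : thetaPhi 0 = 1 := by simp [thetaPhi, eulerProd_zero]

lemma thetaPsi_zero : thetaPsi 0 = 1 := by simp [thetaPsi, eulerProd_zero]

lemma thetaPsiNeg_zero : thetaPsiNeg 0 = 1 := by simp [thetaPsiNeg, eulerProd_zero]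

lemma hasEulerLog_thetaPhi (hq : ‖q‖ < 1) (hq0 : q ≠ 0) : HasEulerLog thetaPhi
    (10 * eulerLog (q ^ 2) - 2 * eulerLog q - 8 * eulerLog (q ^ 4)) q := by
  have h1 := eulerProd_ne_zero hq
  have h4 := eulerProd_ne_zero (norm_pow_lt_one hq (k := 4) (by simp))
  exact HasEulerLog.congr_log (((hasEulerLog_eulerProd_pow hq hq0 (k := 2) (by simp)).pow 5).div
    (((hasEulerLog_eulerProd hq hq0).pow 2).mul
      ((hasEulerLog_eulerProd_pow hq hq0 (k := 4) (by simp)).pow 2)) (by simp [h1, h4])) (by push_cast; ring)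

lemma hasEulerLog_thetaPhiNeg (hq : ‖q‖ < 1) (hq0 : q ≠ 0) :
    HasEulerLog thetaPhiNeg (2 * eulerLog q - 2 * eulerLog (q ^ 2)) q := by
  exact HasEulerLog.congr_log (((hasEulerLog_eulerProd hq hq0).pow 2).div
    (hasEulerLog_eulerProd_pow hq hq0 (k := 2) (by simp))
    (eulerProd_ne_zero (norm_pow_lt_one hq (k := 2) (by simp)))) (by push_cast; ring)

lemma hasEulerLog_thetaPsi (hq : ‖q‖ < 1) (hq0 : q ≠ 0) :
    HasEulerLog thetaPsi (4 * eulerLog (q ^ 2) - eulerLog q) q := by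
  exact HasEulerLog.congr_log (((hasEulerLog_eulerProd_pow hq hq0 (k := 2) (by simp)).pow 2).div
    (hasEulerLog_eulerProd hq hq0) (eulerProd_ne_zero hq)) (by push_cast; ring)

lemma hasEulerLog_thetaPsiNeg (hq : ‖q‖ < 1) (hq0 : q ≠ 0) : HasEulerLog thetaPsiNeg
    (eulerLog q + 4 * eulerLog (q ^ 4) - 2 * eulerLog (q ^ 2)) q := by
  exact HasEulerLog.congr_log (((hasEulerLog_eulerProd hq hq0).mul
    (hasEulerLog_eulerProd_pow hq hq0 (k := 4) (by simp))).div
    (hasEulerLog_eulerProd_pow hq hq0 (k := 2) (by simp))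
    (eulerProd_ne_zero (norm_pow_lt_one hq (k := 2) (by simp)))) (by push_cast; ring)

lemma thetaPhi_sq_add (hq : ‖q‖ < 1) (hq0 : q ≠ 0) :
    thetaPhi q ^ 2 + thetaPhiNeg q ^ 2 = 2 * thetaPhi (q ^ 2) ^ 2 := by
  have h := tsum_zpow_sq_sq_add hq hq0
  rwa [tsum_zpow_sq hq hq0, tsum_neg_one_zpow_mul_zpow_sq hq hq0,
    tsum_zpow_sq (norm_pow_lt_one hq two_ne_zero) (pow_ne_zero 2 hq0)] at h

lemma thetaPhi_sq_sub (hq : ‖q‖ < 1) (hq0 : q ≠ 0) :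
    thetaPhi q ^ 2 - thetaPhiNeg q ^ 2 = 8 * q * thetaPsi (q ^ 4) ^ 2 := by
  have h := tsum_zpow_sq_sq_sub hq hq0
  rw [tsum_zpow_sq hq hq0, tsum_neg_one_zpow_mul_zpow_sq hq hq0,
    tsum_zpow_sq_add (norm_pow_lt_one hq two_ne_zero) (pow_ne_zero 2 hq0)] at h
  rw [thetaPhi, thetaPhiNeg, h, thetaPsi]
  ring_nf

lemma thetaPsi_sq (hq : ‖q‖ < 1) : thetaPsi q ^ 2 = thetaPhi q * thetaPsi (q ^ 2) := by
  have h1 := eulerProd_ne_zero hq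
  have h2 := eulerProd_ne_zero (norm_pow_lt_one hq (k := 2) (by simp))
  have h4 := eulerProd_ne_zero (norm_pow_lt_one hq (k := 4) (by simp))
  rw [thetaPsi, thetaPsi, thetaPhi, ← pow_mul]
  field_simp

lemma thetaPsiNeg_sq_mul_thetaPhi (hq : ‖q‖ < 1) :
    thetaPsiNeg q ^ 2 * thetaPhi q = thetaPsi q ^ 2 * thetaPhiNeg q := by
  have h1 := eulerProd_ne_zero hq
  have h2 := eulerProd_ne_zero (norm_pow_lt_one hq (k := 2) (by simp))
  have h4 := eulerProd_ne_zero (norm_pow_lt_one hq (k := 4) (by simp))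
  rw [thetaPhiNeg, thetaPsiNeg, thetaPhi, thetaPsi]
  field_simp

/-- Jacobi's quartic identity `φ(q)⁴ - φ(-q)⁴ = 16 q ψ(q²)⁴`. -/
lemma thetaPhi_pow_four_sub (hq : ‖q‖ < 1) (hq0 : q ≠ 0) :
    thetaPhi q ^ 4 - thetaPhiNeg q ^ 4 = 16 * q * thetaPsi (q ^ 2) ^ 4 := by
  have h1 := thetaPhi_sq_add hq hq0
  have h2 := thetaPhi_sq_sub hq hq0
  have h3 := thetaPsi_sq (norm_pow_lt_one hq two_ne_zero)
  rw [← pow_mul] at h3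
  linear_combination (thetaPhi q ^ 2 - thetaPhiNeg q ^ 2) * h1 + 2 * thetaPhi (q ^ 2) ^ 2 * h2 -
    16 * q * (thetaPsi (q ^ 2) ^ 2 + thetaPhi (q ^ 2) * thetaPsi (q ^ (2 * 2))) * h3

lemma thetaPsi_mul_seven_sub (hq : ‖q‖ < 1) (hq0 : q ≠ 0) :
    thetaPsi q * thetaPsi (q ^ 7) - thetaPsiNeg q * thetaPsiNeg (q ^ 7) =
      2 * q * (thetaPsi (q ^ 2) * thetaPsi (q ^ 14)) := by
  have h := tsum_zpow_triangular_mul_seven hq hq0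
  have h7 := norm_pow_lt_one hq (k := 7) (by simp)
  have h70 := pow_ne_zero 7 hq0
  rwa [tsum_zpow_triangular hq hq0, tsum_zpow_triangular h7 h70,
    tsum_neg_one_zpow_mul_zpow_triangular hq hq0, tsum_neg_one_zpow_mul_zpow_triangular h7 h70,
    tsum_zpow_triangular (norm_pow_lt_one hq two_ne_zero) (pow_ne_zero 2 hq0),
    tsum_zpow_triangular (norm_pow_lt_one hq (k := 14) (by simp)) (pow_ne_zero 14 hq0)] at h

end thetaBasics

lemma eq_of_comp_sq_eq {R : ℂ → ℂ} (hR : ContinuousAt R 0)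
    (h : ∀ x : ℂ, ‖x‖ < 1 → R (x ^ 2) = R x) {q : ℂ} (hq : ‖q‖ < 1) : R q = R 0 := by
  have h1 : ∀ n : ℕ, R (q ^ 2 ^ n) = R q := fun n ↦ by
    induction n with
    | zero => simp
    | succ n ih => rw [pow_succ, pow_mul, h _ (norm_pow_lt_one hq (by positivity)), ih]
  have h2 : Tendsto (fun n : ℕ ↦ q ^ 2 ^ n) atTop (𝓝 0) :=
    (tendsto_pow_atTop_nhds_zero_of_norm_lt_one hq).comp
      (tendsto_pow_atTop_atTop_of_one_lt one_lt_two)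
  have h3 := hR.tendsto.comp h2
  simp only [Function.comp_def, h1] at h3
  exact tendsto_nhds_unique tendsto_const_nhds h3

section thetaLogs

variable {q : ℂ}

lemma eulerLog_quadratic_transform (hq : ‖q‖ < 1) (hq0 : q ≠ 0) :
    thetaPhi (q ^ 2) ^ 2 * (12 * eulerLog (q ^ 4) - 4 * eulerLog (q ^ 2) - 8 * eulerLog (q ^ 8)) =
      q * thetaPsi (q ^ 4) ^ 2 *
        (12 * eulerLog (q ^ 2) - 4 * eulerLog q - 8 * eulerLog (q ^ 4)) := by
  have h := HasEulerLog.add_eq hq0 ((hasEulerLog_thetaPhi hq hq0).pow 2)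
    ((hasEulerLog_thetaPhiNeg hq hq0).pow 2)
    ((((hasEulerLog_thetaPhi (norm_pow_lt_one hq two_ne_zero)
      (pow_ne_zero 2 hq0)).comp_pow hq0).pow 2).const_mul 2)
    ((eventually_norm_lt_one_ne_zero hq hq0).mono fun x hx ↦ thetaPhi_sq_add hx.1 hx.2)
  have h1 := thetaPhi_sq_add hq hq0
  have h2 := thetaPhi_sq_sub hq hq0
  simp only [← pow_mul] at h
  push_cast at h
  linear_combination -h / 8 + (8 * eulerLog (q ^ 2) - 8 * eulerLog (q ^ 4)) / 8 * h1 +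
    (12 * eulerLog (q ^ 2) - 4 * eulerLog q - 8 * eulerLog (q ^ 4)) / 8 * h2

/-- The difference of the logarithmic Euler derivatives of `φ(q)` and `φ(-q)`. -/
lemma eulerLog_phi_sub_phiNeg (hq : ‖q‖ < 1) :
    12 * eulerLog (q ^ 2) - 4 * eulerLog q - 8 * eulerLog (q ^ 4) =
      4 * q * thetaPsi (q ^ 2) ^ 4 := by
  let N : ℂ → ℂ := fun x ↦ 3 * x * logDeriv eulerProd (x ^ 2) - logDeriv eulerProd x -
    2 * x ^ 3 * logDeriv eulerProd (x ^ 4)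
  have hN : ∀ x : ℂ, 12 * eulerLog (x ^ 2) - 4 * eulerLog x - 8 * eulerLog (x ^ 4) =
      4 * x * N x := fun x ↦ by simp only [N, eulerLog]; ring
  have hc : ContinuousAt (fun x ↦ N x / thetaPsi (x ^ 2) ^ 4) 0 := by
    have hL : ∀ k : ℕ, k ≠ 0 → ContinuousAt (fun x : ℂ ↦ logDeriv eulerProd (x ^ k)) 0 :=
      fun k hk ↦ ContinuousAt.comp' (f := fun x : ℂ ↦ x ^ k)
        (analyticAt_logDeriv_eulerProd (by simp [hk])).continuousAt (by fun_prop)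
    have hP : ContinuousAt (fun x : ℂ ↦ thetaPsi (x ^ 2)) 0 :=
      ContinuousAt.comp' (f := fun x : ℂ ↦ x ^ 2)
        (analyticAt_thetaPsi (by simp)).continuousAt (by fun_prop)
    have h1 := hL 1 one_ne_zero
    simp only [pow_one] at h1
    have h2 := hL 2 (by simp)
    have h4 := hL 4 (by simp)
    refine ContinuousAt.div ?_ (hP.pow 4) (by simp [thetaPsi_zero])
    exact ((ContinuousAt.mul (by fun_prop) h2).sub h1).sub (ContinuousAt.mul (by fun_prop) h4)
  have hR := eq_of_comp_sq_eq hc (fun x hx ↦ ?_) hq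
  · have h2 := thetaPsi_ne_zero (norm_pow_lt_one hq two_ne_zero)
    rw [hN]
    simp [N, thetaPsi_zero, logDeriv_eulerProd_zero] at hR
    rw [div_eq_one_iff_eq (pow_ne_zero 4 h2)] at hR
    linear_combination 4 * q * hR
  · rcases eq_or_ne x 0 with rfl | hx0
    · simp
    have h2 := thetaPsi_ne_zero (norm_pow_lt_one hx (k := 2) (by simp))
    have h4 := thetaPsi_ne_zero (norm_pow_lt_one hx (k := 4) (by simp))
    have h5 := thetaPsi_sq (norm_pow_lt_one hx two_ne_zero)
    have h6 := eulerLog_quadratic_transform hx hx0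
    have h7 := hN (x ^ 2)
    simp only [← pow_mul, Nat.reduceMul] at h5 h7 ⊢
    rw [h7, hN] at h6
    have h8 : thetaPhi (x ^ 2) ^ 2 * N (x ^ 2) = thetaPsi (x ^ 4) ^ 2 * N x := by
      refine mul_left_cancel₀ (pow_ne_zero 2 hx0) ?_
      linear_combination h6 / 4
    rw [div_eq_div_iff (pow_ne_zero 4 h4) (pow_ne_zero 4 h2)]
    linear_combination thetaPsi (x ^ 4) ^ 2 * h8 + N (x ^ 2) * (thetaPsi (x ^ 2) ^ 2 +
      thetaPhi (x ^ 2) * thetaPsi (x ^ 4)) * h5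

lemma eulerLog_phiNeg_pow_four (hq : ‖q‖ < 1) (hq0 : q ≠ 0) :
    1 + 64 * eulerLog (q ^ 4) - 48 * eulerLog (q ^ 2) + 8 * eulerLog q = thetaPhiNeg q ^ 4 := by
  have hq2 := norm_pow_lt_one hq two_ne_zero
  have h := HasEulerLog.add_eq hq0 (((hasEulerLog_id hq0).mul
      (((hasEulerLog_thetaPsi hq2 (pow_ne_zero 2 hq0)).comp_pow hq0).pow 4)).const_mul 16)
    ((hasEulerLog_thetaPhiNeg hq hq0).pow 4) ((hasEulerLog_thetaPhi hq hq0).pow 4)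
    ((eventually_norm_lt_one_ne_zero hq hq0).mono fun x hx ↦ by
      linear_combination -thetaPhi_pow_four_sub hx.1 hx.2)
  have h1 := thetaPhi_pow_four_sub hq hq0
  have h2 := eulerLog_phi_sub_phiNeg hq
  have h3 := thetaPsi_ne_zero hq2
  simp only [← pow_mul, Nat.reduceMul] at h
  push_cast at h
  refine mul_left_cancel₀ (mul_ne_zero hq0 (pow_ne_zero 4 h3)) ?_
  linear_combination h / 16 +
    (10 * eulerLog (q ^ 2) - 2 * eulerLog q - 8 * eulerLog (q ^ 4)) / 4 * h1 +
    thetaPhiNeg q ^ 4 / 4 * h2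

end thetaLogs

/-- The elliptic modulus `k² = 16 q ψ(q²)⁴ / φ(q)⁴`. -/
def thetaModulus (q : ℂ) : ℂ := 16 * q * thetaPsi (q ^ 2) ^ 4 / thetaPhi q ^ 4

/-- The eighth root of the product of the moduli at `q` and `q⁷`. -/
def septicU (q : ℂ) : ℂ :=
  2 * q * (thetaPsi (q ^ 2) * thetaPsi (q ^ 14)) / (thetaPsi q * thetaPsi (q ^ 7))

/-- The eighth root of the product of the complementary moduli at `q` and `q⁷`. -/
def septicV (q : ℂ) : ℂ :=
  thetaPsiNeg q * thetaPsiNeg (q ^ 7) / (thetaPsi q * thetaPsi (q ^ 7))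

section septic

variable {q : ℂ}

lemma thetaPhi_pow_four_mul_modulus (hq : ‖q‖ < 1) :
    thetaPhi q ^ 4 * thetaModulus q = 16 * q * thetaPsi (q ^ 2) ^ 4 :=
  mul_div_cancel₀ _ (pow_ne_zero 4 (thetaPhi_ne_zero hq))

lemma thetaPhi_pow_four_mul_one_sub_modulus (hq : ‖q‖ < 1) (hq0 : q ≠ 0) :
    thetaPhi q ^ 4 * (1 - thetaModulus q) = thetaPhiNeg q ^ 4 := by
  linear_combination thetaPhi_pow_four_sub hq hq0 - thetaPhi_pow_four_mul_modulus hq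

lemma septicU_add_septicV (hq : ‖q‖ < 1) (hq0 : q ≠ 0) : septicU q + septicV q = 1 := by
  have h := thetaPsi_mul_seven_sub hq hq0
  have h1 := thetaPsi_ne_zero hq
  have h7 := thetaPsi_ne_zero (norm_pow_lt_one hq (k := 7) (by simp))
  rw [septicU, septicV, ← h]
  field_simp
  ring

lemma septicU_pow_eight (hq : ‖q‖ < 1) :
    septicU q ^ 8 = thetaModulus q * thetaModulus (q ^ 7) := by
  have hq7 := norm_pow_lt_one hq (k := 7) (by simp)
  have h1 := thetaPsi_sq hq
  have h7 := thetaPsi_sq hq7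
  have n1 := thetaPsi_ne_zero hq
  have n7 := thetaPsi_ne_zero hq7
  have m1 := thetaPhi_ne_zero hq
  have m7 := thetaPhi_ne_zero hq7
  have e1 : thetaPsi q ^ 8 = thetaPhi q ^ 4 * thetaPsi (q ^ 2) ^ 4 := by
    rw [← mul_pow, ← h1]; ring
  have e7 : thetaPsi (q ^ 7) ^ 8 = thetaPhi (q ^ 7) ^ 4 * thetaPsi (q ^ 14) ^ 4 := by
    rw [← mul_pow, show q ^ 14 = (q ^ 7) ^ 2 by ring, ← h7]; ring
  rw [septicU, thetaModulus, thetaModulus, ← pow_mul, div_pow, mul_pow (thetaPsi q), e1, e7,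
    div_mul_div_comm, div_eq_div_iff]
  · ring
  · rw [← e1, ← e7]
    positivity
  · positivity

lemma septicV_pow_eight (hq : ‖q‖ < 1) (hq0 : q ≠ 0) :
    septicV q ^ 8 = (1 - thetaModulus q) * (1 - thetaModulus (q ^ 7)) := by
  have key : ∀ {x : ℂ}, ‖x‖ < 1 → x ≠ 0 →
      (thetaPsiNeg x / thetaPsi x) ^ 8 = 1 - thetaModulus x := fun {x} hx hx0 ↦ by
    have h1 := thetaPsiNeg_sq_mul_thetaPhi hx
    have n1 := thetaPsi_ne_zero hx
    have m1 := thetaPhi_ne_zero hx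
    have h2 := thetaPhi_pow_four_mul_one_sub_modulus hx hx0
    have h3 : (thetaPsiNeg x ^ 2 * thetaPhi x) ^ 4 = (thetaPsi x ^ 2 * thetaPhiNeg x) ^ 4 := by
      rw [h1]
    rw [div_pow, div_eq_iff (pow_ne_zero 8 n1)]
    refine mul_right_cancel₀ (pow_ne_zero 4 m1) ?_
    linear_combination h3 - thetaPsi x ^ 8 * h2
  rw [← key hq hq0, ← key (norm_pow_lt_one hq (k := 7) (by simp)) (pow_ne_zero 7 hq0), ← mul_pow,
    div_mul_div_comm, septicV]

lemma hasEulerLog_septicU (hq : ‖q‖ < 1) (hq0 : q ≠ 0) : HasEulerLog septicU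
    ((thetaPhi q ^ 4 * (1 - thetaModulus q) +
      7 * (thetaPhi (q ^ 7) ^ 4 * (1 - thetaModulus (q ^ 7)))) / 8) q := by
  have hk : ∀ {k : ℕ}, k ≠ 0 → HasEulerLog (fun x ↦ thetaPsi (x ^ k))
      (k * (4 * eulerLog ((q ^ k) ^ 2) - eulerLog (q ^ k))) q := fun {k} hk ↦
    (hasEulerLog_thetaPsi (norm_pow_lt_one hq hk) (pow_ne_zero k hq0)).comp_pow hq0
  have hq7 := norm_pow_lt_one hq (k := 7) (by simp)
  have h := (((hasEulerLog_id hq0).const_mul 2).mul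
    ((hk (k := 2) (by simp)).mul (hk (k := 14) (by simp)))).div
    ((hasEulerLog_thetaPsi hq hq0).mul (hk (k := 7) (by simp)))
    (mul_ne_zero (thetaPsi_ne_zero hq) (thetaPsi_ne_zero hq7))
  refine h.congr_log ?_
  rw [thetaPhi_pow_four_mul_one_sub_modulus hq hq0,
    thetaPhi_pow_four_mul_one_sub_modulus hq7 (pow_ne_zero 7 hq0),
    ← eulerLog_phiNeg_pow_four hq hq0, ← eulerLog_phiNeg_pow_four hq7 (pow_ne_zero 7 hq0)]
  simp only [← pow_mul, Nat.reduceMul]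
  push_cast
  ring

lemma hasEulerLog_septicV (hq : ‖q‖ < 1) (hq0 : q ≠ 0) : HasEulerLog septicV
    (-(thetaPhi q ^ 4 * thetaModulus q + 7 * (thetaPhi (q ^ 7) ^ 4 * thetaModulus (q ^ 7))) / 8)
    q := by
  have hq7 := norm_pow_lt_one hq (k := 7) (by simp)
  have hq70 := pow_ne_zero 7 hq0
  have h := ((hasEulerLog_thetaPsiNeg hq hq0).mul
    ((hasEulerLog_thetaPsiNeg hq7 hq70).comp_pow hq0)).div
    ((hasEulerLog_thetaPsi hq hq0).mul ((hasEulerLog_thetaPsi hq7 hq70).comp_pow hq0))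
    (mul_ne_zero (thetaPsi_ne_zero hq) (thetaPsi_ne_zero hq7))
  refine h.congr_log ?_
  have h1 := eulerLog_phi_sub_phiNeg hq
  have h7 := eulerLog_phi_sub_phiNeg hq7
  rw [thetaPhi_pow_four_mul_modulus hq, thetaPhi_pow_four_mul_modulus hq7]
  push_cast
  linear_combination -h1 / 2 - 7 * h7 / 2

/-- The consequence of differentiating `u + v = 1`. -/
lemma septicU_mul_eq (hq : ‖q‖ < 1) (hq0 : q ≠ 0) :
    septicU q * (thetaPhi q ^ 4 + 7 * thetaPhi (q ^ 7) ^ 4) =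
      thetaPhi q ^ 4 * thetaModulus q + 7 * (thetaPhi (q ^ 7) ^ 4 * thetaModulus (q ^ 7)) := by
  have h := HasEulerLog.add_eq (k := 0) (h := fun _ ↦ 1) hq0 (hasEulerLog_septicU hq hq0)
    (hasEulerLog_septicV hq hq0) ((hasDerivAt_const q (1 : ℂ)).congr_deriv (by simp))
    ((eventually_norm_lt_one_ne_zero hq hq0).mono fun x hx ↦ septicU_add_septicV hx.1 hx.2)
  have h1 := septicU_add_septicV hq hq0
  linear_combination 8 * h + (thetaPhi q ^ 4 * thetaModulus q +
    7 * (thetaPhi (q ^ 7) ^ 4 * thetaModulus (q ^ 7))) * h1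

lemma septic_sq_eq (hq : ‖q‖ < 1) (hq0 : q ≠ 0) :
    (thetaPhi q ^ 2 * (thetaModulus q - septicU q)) ^ 2 =
      (7 * thetaPhi (q ^ 7) ^ 2 * (septicU q * septicV q * (1 - septicU q * septicV q))) ^ 2 := by
  have h1 := septicU_mul_eq hq hq0
  have h2 := septicU_pow_eight hq
  have h3 := septicV_pow_eight hq hq0
  have h4 : septicV q = 1 - septicU q := by linear_combination septicU_add_septicV hq hq0
  rw [h4] at h3 ⊢
  linear_combination (septicU q - thetaModulus q) * h1 +
    7 * thetaPhi (q ^ 7) ^ 4 * ((1 - septicU q) * h2 + septicU q * h3)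

end septic

section nearZero

lemma continuousAt_comp_pow_zero {f : ℂ → ℂ} (hf : ContinuousAt f 0) {k : ℕ} (hk : k ≠ 0) :
    ContinuousAt (fun x ↦ f (x ^ k)) 0 :=
  ContinuousAt.comp' (f := fun x : ℂ ↦ x ^ k) (by simpa [hk] using hf) (by fun_prop)

lemma continuousAt_septicV_zero : ContinuousAt septicV 0 := by
  have h1 := (analyticAt_thetaPsi (q := 0) (by simp)).continuousAt
  have h2 := (analyticAt_thetaPsiNeg (q := 0) (by simp)).continuousAt
  exact (h2.mul (continuousAt_comp_pow_zero h2 (k := 7) (by simp))).div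
    (h1.mul (continuousAt_comp_pow_zero h1 (k := 7) (by simp))) (by simp [thetaPsi_zero])

lemma septicV_zero : septicV 0 = 1 := by simp [septicV, thetaPsi_zero, thetaPsiNeg_zero]

lemma continuousAt_septicU_div_zero : ContinuousAt (fun x ↦
    2 * (thetaPsi (x ^ 2) * thetaPsi (x ^ 14)) / (thetaPsi x * thetaPsi (x ^ 7))) 0 := by
  have h1 := (analyticAt_thetaPsi (q := 0) (by simp)).continuousAt
  exact (continuousAt_const.mul ((continuousAt_comp_pow_zero h1 (k := 2) (by simp)).mul
      (continuousAt_comp_pow_zero h1 (k := 14) (by simp)))).div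
    (h1.mul (continuousAt_comp_pow_zero h1 (k := 7) (by simp))) (by simp [thetaPsi_zero])

lemma septicU_eq (x : ℂ) : septicU x =
    x * (2 * (thetaPsi (x ^ 2) * thetaPsi (x ^ 14)) / (thetaPsi x * thetaPsi (x ^ 7))) := by
  rw [septicU]
  ring

lemma eventually_norm_lt_one_nhdsNE_zero : ∀ᶠ x in 𝓝[≠] (0 : ℂ), ‖x‖ < 1 ∧ x ≠ 0 :=
  ((eventually_nhdsWithin_of_eventually_nhds (Metric.ball_mem_nhds 0 one_pos)).mono
    fun x hx ↦ by simpa using hx).and eventually_mem_nhdsWithin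

/-- The square root of `septic_sq_eq`, with the sign fixed by the behaviour at the cusp. -/
lemma eventually_septic_eq : ∀ᶠ x in 𝓝[≠] (0 : ℂ),
    thetaPhi x ^ 2 * (thetaModulus x - septicU x) =
      7 * thetaPhi (x ^ 7) ^ 2 * (septicU x * septicV x * (1 - septicU x * septicV x)) := by
  have hphi := (analyticAt_thetaPhi (q := 0) (by simp)).continuousAt
  have hpsi := (analyticAt_thetaPsi (q := 0) (by simp)).continuousAt
  let U : ℂ → ℂ := fun x ↦
    2 * (thetaPsi (x ^ 2) * thetaPsi (x ^ 14)) / (thetaPsi x * thetaPsi (x ^ 7))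
  have hU : ContinuousAt U 0 := continuousAt_septicU_div_zero
  let G : ℂ → ℂ := fun x ↦ thetaPhi x ^ 2 * (16 * thetaPsi (x ^ 2) ^ 4 / thetaPhi x ^ 4 - U x) +
    7 * thetaPhi (x ^ 7) ^ 2 * (U x * septicV x * (1 - x * U x * septicV x))
  have hG : ContinuousAt G 0 := by
    have hA : ContinuousAt (fun x ↦ 16 * thetaPsi (x ^ 2) ^ 4 / thetaPhi x ^ 4) 0 :=
      (continuousAt_const.mul ((continuousAt_comp_pow_zero hpsi (k := 2) (by simp)).pow 4)).div
        (hphi.pow 4) (by simp [thetaPhi_zero])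
    have hB := continuousAt_comp_pow_zero hphi (k := 7) (by simp)
    have hV := continuousAt_septicV_zero
    exact ((hphi.pow 2).mul (hA.sub hU)).add ((continuousAt_const.mul (hB.pow 2)).mul
      ((hU.mul hV).mul (continuousAt_const.sub ((continuousAt_id.mul hU).mul hV))))
  have hG0 : G 0 ≠ 0 := by
    simp [G, U, thetaPhi_zero, thetaPsi_zero, septicV_zero]
    norm_num
  filter_upwards [eventually_norm_lt_one_nhdsNE_zero,
    eventually_nhdsWithin_of_eventually_nhds (hG.eventually_ne hG0)] with x ⟨hx, hx0⟩ hGx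
  rcases sq_eq_sq_iff_eq_or_eq_neg.mp (septic_sq_eq hx hx0) with h | h
  · exact h
  · refine absurd ?_ (mul_ne_zero hx0 hGx)
    have hu : septicU x = x * U x := septicU_eq x
    rw [hu, thetaModulus] at h
    simp only [G]
    linear_combination h

lemma septic_eq_dual {x : ℂ} (hx : ‖x‖ < 1) (hx0 : x ≠ 0)
    (h : thetaPhi x ^ 2 * (thetaModulus x - septicU x) =
      7 * thetaPhi (x ^ 7) ^ 2 * (septicU x * septicV x * (1 - septicU x * septicV x))) :
    thetaPhi x ^ 2 * (septicU x * septicV x * (1 - septicU x * septicV x)) =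
      thetaPhi (x ^ 7) ^ 2 * (septicU x - thetaModulus (x ^ 7)) := by
  refine mul_left_cancel₀
    (pow_ne_zero 2 (thetaPhi_ne_zero (norm_pow_lt_one hx (k := 7) (by simp)))) ?_
  linear_combination -thetaPhi x ^ 2 / 7 * h - septicU_mul_eq hx hx0 / 7

/-- The modular equation of degree seven for the multiplier `φ(q)² / φ(q⁷)²`. -/
lemma eventually_multiplier_eq : ∀ᶠ x in 𝓝[≠] (0 : ℂ),
    7 * thetaPhi (x ^ 7) ^ 4 - thetaPhi x ^ 4 = thetaPhi x ^ 2 * thetaPhi (x ^ 7) ^ 2 *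
      (6 - 16 * septicU x + 12 * septicU x ^ 2 - 8 * septicU x ^ 3) := by
  have hc : ContinuousAt (fun x ↦ 1 - septicU x * septicV x) 0 := by
    have hU : ContinuousAt septicU 0 :=
      (continuousAt_id.mul continuousAt_septicU_div_zero).congr
        (.of_forall fun x ↦ (septicU_eq x).symm)
    exact continuousAt_const.sub (hU.mul continuousAt_septicV_zero)
  filter_upwards [eventually_norm_lt_one_nhdsNE_zero, eventually_septic_eq,
    eventually_nhdsWithin_of_eventually_nhds (hc.eventually_ne (y := 0) (by simp [septicU]))]
    with x ⟨hx, hx0⟩ h hp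
  have h7 := norm_pow_lt_one hx (k := 7) (by simp)
  have n1 := thetaPsi_ne_zero hx
  have n7 := thetaPsi_ne_zero h7
  have hu : septicU x ≠ 0 := div_ne_zero (mul_ne_zero (mul_ne_zero two_ne_zero hx0)
    (mul_ne_zero (thetaPsi_ne_zero (norm_pow_lt_one hx (by simp)))
      (thetaPsi_ne_zero (norm_pow_lt_one hx (by simp))))) (mul_ne_zero n1 n7)
  have hv : septicV x ≠ 0 :=
    div_ne_zero (mul_ne_zero (thetaPsiNeg_ne_zero hx) (thetaPsiNeg_ne_zero h7))
      (mul_ne_zero n1 n7)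
  have h2 := septicU_pow_eight hx
  have h3 := septicU_add_septicV hx hx0
  have h4 := septic_eq_dual hx hx0 h
  have h5 : septicV x = 1 - septicU x := by linear_combination h3
  rw [h5] at h h4 hp hv
  refine mul_left_cancel₀ (mul_ne_zero (pow_ne_zero 2 hu) (mul_ne_zero hv hp)) ?_
  linear_combination -thetaPhi x ^ 2 * thetaPhi (x ^ 7) ^ 2 * h2 -
    thetaPhi (x ^ 7) ^ 2 * thetaModulus (x ^ 7) * h -
    (thetaPhi x ^ 2 * septicU x + 7 * thetaPhi (x ^ 7) ^ 2 *
      (septicU x * (1 - septicU x) * (1 - septicU x * (1 - septicU x)))) * h4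

end nearZero

lemma eventually_eulerLog_multiplier : ∀ᶠ x in 𝓝[≠] (0 : ℂ),
    2 * (10 * eulerLog (x ^ 2) - 2 * eulerLog x - 8 * eulerLog (x ^ 4)) -
      14 * (10 * eulerLog (x ^ 14) - 2 * eulerLog (x ^ 7) - 8 * eulerLog (x ^ 28)) =
    thetaPhi x ^ 2 * thetaPhi (x ^ 7) ^ 2 * (septicU x * septicV x *
      (2 - 3 * septicU x + 3 * septicU x ^ 2)) := by
  have hc : ContinuousAt (fun x ↦ 7 * thetaPhi (x ^ 7) ^ 4 + thetaPhi x ^ 4) 0 := by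
    have hphi := (analyticAt_thetaPhi (q := 0) (by simp)).continuousAt
    exact (continuousAt_const.mul ((continuousAt_comp_pow_zero hphi (by simp)).pow 4)).add
      (hphi.pow 4)
  filter_upwards [eventually_norm_lt_one_nhdsNE_zero,
    eventually_eventually_nhdsWithin.mpr eventually_multiplier_eq, eventually_multiplier_eq,
    eventually_nhdsWithin_of_eventually_nhds (hc.eventually_ne (y := 0)
      (by simp [thetaPhi_zero]; norm_num))] with x ⟨hx, hx0⟩ hev hm hne
  rw [isOpen_compl_singleton.nhdsWithin_eq hx0] at hev
  have hP := hasEulerLog_thetaPhi hx hx0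
  have hP7 := (hasEulerLog_thetaPhi (norm_pow_lt_one hx (k := 7) (by simp))
    (pow_ne_zero 7 hx0)).comp_pow hx0
  have hU : HasDerivAt _ _ _ := hasEulerLog_septicU hx hx0
  have hA : HasDerivAt _ _ _ := (hP7.pow 4).const_mul 7
  have hB : HasDerivAt _ _ _ := hP.pow 4
  have hC : HasDerivAt _ _ _ := (hP.pow 2).mul (hP7.pow 2)
  have hH := (((hU.const_mul 16).const_sub 6).fun_add ((hU.fun_pow 2).const_mul 12)).fun_sub
    ((hU.fun_pow 3).const_mul 8)
  have h := (hA.fun_sub hB).unique ((hC.fun_mul hH).congr_of_eventuallyEq hev)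
  have h1 := septicU_mul_eq hx hx0
  have h3 : septicV x = 1 - septicU x := by linear_combination septicU_add_septicV hx hx0
  simp only [← pow_mul, Nat.reduceMul] at h
  push_cast at h
  rw [h3]
  field_simp at h
  refine mul_left_cancel₀ hne ?_
  linear_combination -h / 8 +
    (2 * (10 * eulerLog (x ^ 2) - 2 * eulerLog x - 8 * eulerLog (x ^ 4)) +
      14 * (10 * eulerLog (x ^ 14) - 2 * eulerLog (x ^ 7) - 8 * eulerLog (x ^ 28))) * hm +
    thetaPhi x ^ 2 * thetaPhi (x ^ 7) ^ 2 * septicU x *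
      (2 - 3 * septicU x + 3 * septicU x ^ 2) * h1

/-- The eta quotient `η₂⁴η₁₄⁴ / (η₁η₄η₇η₂₈)`. -/
def etaQuotient (q : ℂ) : ℂ := q * (eulerProd (q ^ 2) ^ 4 * eulerProd (q ^ 14) ^ 4 /
  (eulerProd q * eulerProd (q ^ 4) * eulerProd (q ^ 7) * eulerProd (q ^ 28)))

lemma thetaPhi_sq_mul_septic {q : ℂ} (hq : ‖q‖ < 1) :
    thetaPhi q ^ 2 * thetaPhi (q ^ 7) ^ 2 * (septicU q * septicV q) = 2 * etaQuotient q := by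
  have key : ∀ {x : ℂ}, ‖x‖ < 1 → thetaPhi x ^ 2 * thetaPsi (x ^ 2) * thetaPsiNeg x =
      thetaPsi x ^ 2 * (eulerProd (x ^ 2) ^ 4 / (eulerProd x * eulerProd (x ^ 4))) :=
    fun {x} hx ↦ by
      have h1 := eulerProd_ne_zero hx
      have h2 := eulerProd_ne_zero (norm_pow_lt_one hx (k := 2) (by simp))
      have h4 := eulerProd_ne_zero (norm_pow_lt_one hx (k := 4) (by simp))
      have h : thetaPhi x * thetaPsiNeg x =
          eulerProd (x ^ 2) ^ 4 / (eulerProd x * eulerProd (x ^ 4)) := by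
        rw [thetaPhi, thetaPsiNeg]
        field_simp
      rw [← h, thetaPsi_sq hx]
      ring
  have hq7 := norm_pow_lt_one hq (k := 7) (by simp)
  have k1 := key hq
  have k7 := key hq7
  have n1 := thetaPsi_ne_zero hq
  have n7 := thetaPsi_ne_zero hq7
  simp only [← pow_mul, Nat.reduceMul] at k7
  rw [septicU, septicV, div_mul_div_comm, ← mul_div_assoc, div_eq_iff (by simp [n1, n7])]
  calc
    _ = 2 * q * (thetaPhi q ^ 2 * thetaPsi (q ^ 2) * thetaPsiNeg q) *
        (thetaPhi (q ^ 7) ^ 2 * thetaPsi (q ^ 14) * thetaPsiNeg (q ^ 7)) := by ring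
    _ = _ := by
      rw [k1, k7, etaQuotient]
      ring

lemma eventually_thetaPhi_sq_mul_eq : ∀ᶠ x in 𝓝[≠] (0 : ℂ),
    thetaPhi x ^ 2 * thetaPhi (x ^ 7) ^ 2 =
      1 + 4 / 3 * (-eulerLog x + 2 * eulerLog (x ^ 2) - 4 * eulerLog (x ^ 4) +
        7 * eulerLog (x ^ 7) - 14 * eulerLog (x ^ 14) + 28 * eulerLog (x ^ 28)) +
      8 / 3 * etaQuotient x := by
  filter_upwards [eventually_norm_lt_one_nhdsNE_zero, eventually_septic_eq,
    eventually_multiplier_eq, eventually_eulerLog_multiplier] with x ⟨hx, hx0⟩ h hm hD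
  have h' := septic_eq_dual hx hx0 h
  have hx7 := norm_pow_lt_one hx (k := 7) (by simp)
  have hS : ∀ {y : ℂ}, ‖y‖ < 1 → y ≠ 0 →
      1 + 8 * (eulerLog y + 4 * eulerLog (y ^ 4) - 2 * eulerLog (y ^ 2)) =
        8 * (10 * eulerLog (y ^ 2) - 2 * eulerLog y - 8 * eulerLog (y ^ 4)) +
          thetaPhi y ^ 4 * (1 - 2 * thetaModulus y) := fun {y} hy hy0 ↦ by
    linear_combination eulerLog_phiNeg_pow_four hy hy0 - 4 * eulerLog_phi_sub_phiNeg hy -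
      thetaPhi_pow_four_mul_one_sub_modulus hy hy0 + thetaPhi_pow_four_mul_modulus hy
  have h1 := hS hx hx0
  have h7 := hS hx7 (pow_ne_zero 7 hx0)
  have he := thetaPhi_sq_mul_septic hx
  have hv : septicV x = 1 - septicU x := by linear_combination septicU_add_septicV hx hx0
  simp only [← pow_mul, Nat.reduceMul] at h7
  rw [hv] at h h' hD he
  linear_combination h1 / 6 - 7 * h7 / 6 + 2 / 3 * hD + 4 / 3 * he -
    thetaPhi x ^ 2 / 3 * h + 7 / 3 * thetaPhi (x ^ 7) ^ 2 * h' - (1 - 2 * septicU x) / 6 * hm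

section globalization

variable {q : ℂ}

lemma analyticAt_eulerLog_pow (hq : ‖q‖ < 1) {k : ℕ} (hk : k ≠ 0) :
    AnalyticAt ℂ (fun x ↦ eulerLog (x ^ k)) q :=
  AnalyticAt.comp (f := fun x : ℂ ↦ x ^ k) (analyticAt_eulerLog (norm_pow_lt_one hq hk))
    (by fun_prop)

lemma analyticAt_etaQuotient (hq : ‖q‖ < 1) : AnalyticAt ℂ etaQuotient q := by
  have hE : ∀ {k : ℕ}, k ≠ 0 → AnalyticAt ℂ (fun x ↦ eulerProd (x ^ k)) q :=
    analyticAt_eulerProd_pow hq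
  have hne : ∀ {k : ℕ}, k ≠ 0 → eulerProd (q ^ k) ≠ 0 := fun hk ↦
    eulerProd_ne_zero (norm_pow_lt_one hq hk)
  exact analyticAt_id.mul (((hE (by simp)).pow 4 |>.mul ((hE (by simp)).pow 4)).div
    ((((analyticAt_eulerProd hq).mul (hE (by simp))).mul (hE (by simp))).mul (hE (by simp)))
    (mul_ne_zero (mul_ne_zero (mul_ne_zero (eulerProd_ne_zero hq) (hne (by simp)))
      (hne (by simp))) (hne (by simp))))

lemma thetaPhi_sq_mul_eq (hq : ‖q‖ < 1) :
    thetaPhi q ^ 2 * thetaPhi (q ^ 7) ^ 2 =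
      1 + 4 / 3 * (-eulerLog q + 2 * eulerLog (q ^ 2) - 4 * eulerLog (q ^ 4) +
        7 * eulerLog (q ^ 7) - 14 * eulerLog (q ^ 14) + 28 * eulerLog (q ^ 28)) +
      8 / 3 * etaQuotient q := by
  refine AnalyticOnNhd.eqOn_of_preconnected_of_frequently_eq (U := Metric.ball (0 : ℂ) 1)
    (z₀ := 0) (f := fun x ↦ thetaPhi x ^ 2 * thetaPhi (x ^ 7) ^ 2)
    (g := fun x ↦ 1 + 4 / 3 * (-eulerLog x + 2 * eulerLog (x ^ 2) - 4 * eulerLog (x ^ 4) +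
      7 * eulerLog (x ^ 7) - 14 * eulerLog (x ^ 14) + 28 * eulerLog (x ^ 28)) +
      8 / 3 * etaQuotient x) (fun x hx ↦ ?_) (fun x hx ↦ ?_)
    (convex_ball 0 1).isPreconnected (by simp) eventually_thetaPhi_sq_mul_eq.frequently
    (by simpa using hq)
  · have hx1 : ‖x‖ < 1 := by simpa using hx
    exact ((analyticAt_thetaPhi hx1).pow 2).mul ((AnalyticAt.comp (f := fun x : ℂ ↦ x ^ 7)
      (analyticAt_thetaPhi (norm_pow_lt_one hx1 (by simp))) (by fun_prop)).pow 2)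
  · have hx1 : ‖x‖ < 1 := by simpa using hx
    have h1 := analyticAt_eulerLog hx1
    have h2 := analyticAt_eulerLog_pow hx1 (k := 2) (by simp)
    have h4 := analyticAt_eulerLog_pow hx1 (k := 4) (by simp)
    have h7 := analyticAt_eulerLog_pow hx1 (k := 7) (by simp)
    have h14 := analyticAt_eulerLog_pow hx1 (k := 14) (by simp)
    have h28 := analyticAt_eulerLog_pow hx1 (k := 28) (by simp)
    exact (analyticAt_const.add (analyticAt_const.mul
      (((((h1.neg.add (analyticAt_const.mul h2)).sub (analyticAt_const.mul h4)).add
        (analyticAt_const.mul h7)).sub (analyticAt_const.mul h14)).add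
        (analyticAt_const.mul h28)))).add (analyticAt_const.mul (analyticAt_etaQuotient hx1))

lemma tsum_zpow_sq_eq_thetaPhi (hq : ‖q‖ < 1) : ∑' n : ℤ, q ^ (n ^ 2) = thetaPhi q := by
  rcases eq_or_ne q 0 with rfl | hq0
  · rw [tsum_eq_single 0 fun n hn ↦ zero_zpow _ (pow_ne_zero 2 hn), thetaPhi_zero]
    simp
  · exact tsum_zpow_sq hq hq0

lemma hasProd_one_sub_pow_mul (hq : ‖q‖ < 1) {k : ℕ} (hk : k ≠ 0) :
    HasProd (fun n : ℕ ↦ 1 - q ^ (k * (n + 1))) (eulerProd (q ^ k)) := by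
  simpa only [pow_mul, eulerProd] using (multipliable_one_sub_pow (norm_pow_lt_one hq hk)).hasProd

lemma hasSum_lambert_pow (hq : ‖q‖ < 1) {k : ℕ} (hk : k ≠ 0) (c : ℂ) :
    HasSum (fun n : ℕ ↦ c * ((n : ℂ) + 1) * q ^ (k * (n + 1)) / (1 - q ^ (k * (n + 1))))
      (-c * eulerLog (q ^ k)) := by
  have h := (hasSum_lambert (norm_pow_lt_one hq hk)).mul_left c
  rw [mul_neg, ← neg_mul] at h
  simpa only [pow_mul, mul_assoc, mul_div_assoc] using h

end globalization

theorem statement15 (q : ℂ) (hq : ‖q‖ < 1) :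
    (∑' n : ℤ, (q) ^ (n ^ 2)) ^ 2 * (∑' n : ℤ, (q ^ 7) ^ (n ^ 2)) ^ 2 =
      1 + (4 / 3) * ∑' j : ℕ,
        (((j : ℂ) + 1) * q ^ (1 * (j + 1)) / (1 - q ^ (1 * (j + 1))) - 2 * ((j : ℂ) + 1) * q ^ (2 * (j + 1)) / (1 - q ^ (2 * (j + 1))) + 4 * ((j : ℂ) + 1) * q ^ (4 * (j + 1)) / (1 - q ^ (4 * (j + 1)))
          - 7 * ((j : ℂ) + 1) * q ^ (7 * (j + 1)) / (1 - q ^ (7 * (j + 1))) + 14 * ((j : ℂ) + 1) * q ^ (14 * (j + 1)) / (1 - q ^ (14 * (j + 1))) - 28 * ((j : ℂ) + 1) * q ^ (28 * (j + 1)) / (1 - q ^ (28 * (j + 1))))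
        + (8 / 3) * (q * ∏' n : ℕ, ((1 - q ^ (2 * (n + 1))) ^ 4 * (1 - q ^ (14 * (n + 1))) ^ 4 / ((1 - q ^ (1 * (n + 1))) * (1 - q ^ (4 * (n + 1))) * (1 - q ^ (7 * (n + 1))) * (1 - q ^ (28 * (n + 1)))))) := by
  have hS {k : ℕ} (hk : k ≠ 0) := hasSum_lambert_pow hq hk
  have hP {k : ℕ} (hk : k ≠ 0) := hasProd_one_sub_pow_mul hq hk
  have hne {k : ℕ} (hk : k ≠ 0) := eulerProd_ne_zero (norm_pow_lt_one hq hk)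
  have hs := (((((hS one_ne_zero 1).sub (hS two_ne_zero 2)).add (hS four_ne_zero 4)).sub
    (hS (k := 7) (by simp) 7)).add (hS (k := 14) (by simp) 14)).sub (hS (k := 28) (by simp) 28)
  have hp := (((hP two_ne_zero).pow 4).mul ((hP (k := 14) (by simp)).pow 4)).div₀
    ((((hP one_ne_zero).mul (hP four_ne_zero)).mul (hP (k := 7) (by simp))).mul
      (hP (k := 28) (by simp)))
    (mul_ne_zero (mul_ne_zero (mul_ne_zero (hne one_ne_zero) (hne four_ne_zero))
      (hne (by simp))) (hne (by simp)))
  simp only [one_mul (_ : ℂ)] at hs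
  rw [hs.tsum_eq, hp.tprod_eq, tsum_zpow_sq_eq_thetaPhi hq,
    tsum_zpow_sq_eq_thetaPhi (norm_pow_lt_one hq (by simp)), thetaPhi_sq_mul_eq hq, etaQuotient,
    pow_one]
  ring
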